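/- Let L be an aperiodic minimal shift with linear complexity. Then there exists r > 0 such that p_L(n) − p_L(n−1) ≤ r for all n ≥ 2, and consequently lim_{n→∞} p_L(n)/p_L(n−1) = 1. -/

import Mathlib

open MeasureTheory Topology Filter Set

/-- The shift map on one-sided infinite words, erasing the first letter. -/
def shiftMap {A : Type*} (w : ℕ → A) : ℕ → A := fun n => w (n + 1)

/-- A shift space: a closed, shift-invariant subset of `A^ℕ`. -/
def IsShiftSpace {A : Type*} [TopologicalSpace A] (L : Set (ℕ → A)) : Prop :=
  IsClosed L ∧ ∀ w ∈ L, shiftMap w ∈ L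

/-- The finite word `v` occurs in `w` at position `j`. -/
def OccursAt {A : Type*} (w : ℕ → A) (j : ℕ) (v : List A) : Prop :=
  ∀ i : Fin v.length, w (j + i) = v.get i

/-- `v` is a factor (subblock) of the language of `L`. -/
def IsFactor {A : Type*} (L : Set (ℕ → A)) (v : List A) : Prop :=
  ∃ w ∈ L, ∃ j, OccursAt w j v

/-- The cylinder of `v` in `L`: words of `L` having `v` as a prefix. -/
def Cyl {A : Type*} (L : Set (ℕ → A)) (v : List A) : Set (ℕ → A) :=
  {w ∈ L | OccursAt w 0 v}

/-- Strict lexicographic order on infinite words. -/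
def LexLt {A : Type*} [LinearOrder A] (w w' : ℕ → A) : Prop :=
  ∃ n, (∀ i < n, w i = w' i) ∧ w n < w' n

/-- Lexicographic order (non-strict) on infinite words. -/
def LexLe {A : Type*} [LinearOrder A] (w w' : ℕ → A) : Prop := LexLt w w' ∨ w = w'

/-- The word interval `[w, w']` in `L` for the lexicographic order. -/
def wordInterval {A : Type*} [LinearOrder A] (L : Set (ℕ → A)) (w w' : ℕ → A) :
    Set (ℕ → A) := {z ∈ L | LexLe w z ∧ LexLe z w'}

/-- The length-`n` prefix of an infinite word, as a list. -/
def prefixWord {A : Type*} (w : ℕ → A) (n : ℕ) : List A := List.ofFn (fun i : Fin n => w i)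

/-- A factor is left special if it has at least two distinct left one-letter extensions. -/
def IsLeftSpecial {A : Type*} (L : Set (ℕ → A)) (v : List A) : Prop :=
  ∃ a b : A, a ≠ b ∧ IsFactor L (a :: v) ∧ IsFactor L (b :: v)

/-- A factor is right special if it has at least two distinct right one-letter extensions. -/
def IsRightSpecial {A : Type*} (L : Set (ℕ → A)) (v : List A) : Prop :=
  ∃ a b : A, a ≠ b ∧ IsFactor L (v ++ [a]) ∧ IsFactor L (v ++ [b])

/-- The set of infinite left special words: all prefixes are left special factors. -/
def SPset {A : Type*} (L : Set (ℕ → A)) : Set (ℕ → A) :=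
  {w | ∀ n : ℕ, IsLeftSpecial L (prefixWord w n)}

/-- The factor complexity `p_L(n)`: the number of distinct length-`n` factors of `L`. -/
noncomputable def complexity {A : Type*} (L : Set (ℕ → A)) (n : ℕ) : ℕ :=
  Nat.card {v : List A // v.length = n ∧ IsFactor L v}

/-- The number of left special factors of length `n`. -/
noncomputable def splCount {A : Type*} (L : Set (ℕ → A)) (n : ℕ) : ℕ :=
  Nat.card {v : List A // v.length = n ∧ IsFactor L v ∧ IsLeftSpecial L v}

/-- A minimal shift: a nonempty shift space with no nonempty proper subshift. -/
def IsMinimalShift {A : Type*} [TopologicalSpace A] (L : Set (ℕ → A)) : Prop :=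
  IsShiftSpace L ∧ L.Nonempty ∧
    ∀ L' ⊆ L, IsShiftSpace L' → L'.Nonempty → L' = L

/-- Aperiodicity: no periodic word in `L`. -/
def IsAperiodic {A : Type*} (L : Set (ℕ → A)) : Prop :=
  ∀ w ∈ L, ∀ k : ℕ, 0 < k → shiftMap^[k] w ≠ w

/-- The factor set of `L` is prolongable: every factor extends by a letter on both sides. -/
def Prolongable {A : Type*} (L : Set (ℕ → A)) : Prop :=
  ∀ v : List A, IsFactor L v →
    (∃ a : A, IsFactor L (a :: v)) ∧ (∃ b : A, IsFactor L (v ++ [b]))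

section Counting

variable {A α β : Type*} [Fintype A] [DecidableEq β]

open Classical in
/-- If every element of `s` is an extension of its image in `t` by a letter, then `s` is not much
larger than `t`, up to the elements of `t` having at least two extensions. -/
theorem card_le_card_add_mul_card_branching {s : Finset α} {t : Finset β} (f : α → β)
    (g : β → A → α) (hf : ∀ x ∈ s, f x ∈ t) (hg : ∀ x ∈ s, ∃ a, g (f x) a = x) :
    s.card ≤ t.card +
      Fintype.card A * (t.filter fun y => ∃ a b, a ≠ b ∧ g y a ∈ s ∧ g y b ∈ s).card := by
  rw [Finset.card_eq_sum_card_fiberwise (f := f) (t := t) hf, Finset.card_eq_sum_ones t,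
    Finset.card_filter, Finset.mul_sum, ← Finset.sum_add_distrib]
  refine Finset.sum_le_sum fun y _ => ?_
  split_ifs with h
  · have hsub : (s.filter fun x => f x = y) ⊆ Finset.univ.image (g y) := by
      intro x hx
      obtain ⟨hxs, rfl⟩ := Finset.mem_filter.1 hx
      obtain ⟨a, ha⟩ := hg x hxs
      exact Finset.mem_image.2 ⟨a, Finset.mem_univ _, ha⟩
    have := (Finset.card_le_card hsub).trans Finset.card_image_le
    rw [Finset.card_univ] at this
    omega
  · rw [mul_zero, add_zero, Finset.card_le_one]
    intro x hx x' hx'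
    obtain ⟨hxs, hxy⟩ := Finset.mem_filter.1 hx
    obtain ⟨hxs', hxy'⟩ := Finset.mem_filter.1 hx'
    obtain ⟨a, ha⟩ := hg x hxs
    obtain ⟨b, hb⟩ := hg x' hxs'
    rw [hxy] at ha
    rw [hxy'] at hb
    by_contra hne
    refine h ⟨a, b, ?_, ha ▸ hxs, hb ▸ hxs'⟩
    rintro rfl
    exact hne (ha.symm.trans hb)

open Classical in
/-- If every element of `t` has an extension by a letter in `s`, then `s` is larger than `t` by at
least the number of elements of `t` having two extensions. -/
theorem card_add_card_branching_le {s : Finset α} {t : Finset β} (f : α → β)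
    (g : β → A → α) (hf : ∀ x ∈ s, f x ∈ t) (hfg : ∀ y a, f (g y a) = y)
    (hinj : ∀ y, Function.Injective (g y)) (hext : ∀ y ∈ t, ∃ a, g y a ∈ s) :
    t.card + (t.filter fun y => ∃ a b, a ≠ b ∧ g y a ∈ s ∧ g y b ∈ s).card ≤ s.card := by
  rw [Finset.card_eq_sum_card_fiberwise (f := f) (s := s) (t := t) hf, Finset.card_eq_sum_ones t,
    Finset.card_filter, ← Finset.sum_add_distrib]
  refine Finset.sum_le_sum fun y hy => ?_
  split_ifs with h
  · obtain ⟨a, b, hab, ha, hb⟩ := h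
    exact Finset.one_lt_card.2 ⟨g y a, Finset.mem_filter.2 ⟨ha, hfg y a⟩, g y b,
      Finset.mem_filter.2 ⟨hb, hfg y b⟩, (hinj y).ne hab⟩
  · obtain ⟨a, ha⟩ := hext y hy
    exact Finset.card_pos.2 ⟨g y a, Finset.mem_filter.2 ⟨ha, hfg y a⟩⟩

end Counting

section Factors

variable {A : Type*} {L : Set (ℕ → A)}

theorem occursAt_iff {w : ℕ → A} {j : ℕ} {v : List A} :
    OccursAt w j v ↔ ∀ i < v.length, v[i]? = some (w (j + i)) := by
  constructor
  · intro h i hi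
    rw [List.getElem?_eq_getElem hi]
    exact congrArg some (h ⟨i, hi⟩).symm
  · intro h i
    have := h i i.2
    rw [List.getElem?_eq_getElem i.2] at this
    exact (Option.some.inj this).symm

theorem IsFactor.of_infix {u v : List A} (hv : IsFactor L v) (h : u <:+: v) : IsFactor L u := by
  obtain ⟨s, t, rfl⟩ := h
  obtain ⟨w, hw, j, hj⟩ := hv
  rw [occursAt_iff] at hj
  refine ⟨w, hw, j + s.length, occursAt_iff.2 fun i hi => ?_⟩
  have := hj (s.length + i) (by simp; omega)
  rw [List.append_assoc, List.getElem?_append_right (by omega), List.getElem?_append_left (by omega),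
    Nat.add_sub_cancel_left] at this
  rw [this, Nat.add_assoc]

theorem IsFactor.exists_append {v : List A} (hv : IsFactor L v) : ∃ b, IsFactor L (v ++ [b]) := by
  obtain ⟨w, hw, j, hj⟩ := hv
  rw [occursAt_iff] at hj
  refine ⟨w (j + v.length), w, hw, j, occursAt_iff.2 fun i hi => ?_⟩
  rcases Nat.lt_or_ge i v.length with h | h
  · rw [List.getElem?_append_left h, hj i h]
  · obtain rfl : i = v.length := by
      simp at hi
      omega
    simp

theorem Prolongable.exists_extension (hL : Prolongable L) {v : List A} (hv : IsFactor L v)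
    (k l : ℕ) : ∃ x y : List A, x.length = k ∧ y.length = l ∧ IsFactor L (x ++ v ++ y) := by
  have hleft : ∃ x : List A, x.length = k ∧ IsFactor L (x ++ v) := by
    induction k with
    | zero => exact ⟨[], rfl, hv⟩
    | succ k ih =>
      obtain ⟨x, hx, hxv⟩ := ih
      obtain ⟨a, ha⟩ := (hL _ hxv).1
      exact ⟨a :: x, by simp [hx], ha⟩
  obtain ⟨x, hx, hxv⟩ := hleft
  have hright : ∃ y : List A, y.length = l ∧ IsFactor L (x ++ v ++ y) := by
    induction l with
    | zero => exact ⟨[], rfl, by simpa using hxv⟩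
    | succ l ih =>
      obtain ⟨y, hy, hxvy⟩ := ih
      obtain ⟨b, hb⟩ := (hL _ hxvy).2
      exact ⟨y ++ [b], by simp [hy], by simpa using hb⟩
  obtain ⟨y, hy, hxvy⟩ := hright
  exact ⟨x, y, hx, hy, hxvy⟩

/-- A factor is branching if two of its left extensions are right special. -/
def IsBranching (L : Set (ℕ → A)) (v : List A) : Prop :=
  ∃ a b : A, a ≠ b ∧ IsRightSpecial L (a :: v) ∧ IsRightSpecial L (b :: v)

theorem IsRightSpecial.isFactor {v : List A} (h : IsRightSpecial L v) : IsFactor L v := by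
  obtain ⟨a, _, _, ha, _⟩ := h
  exact ha.of_infix (List.infix_append' [] v [a])

theorem IsRightSpecial.of_suffix {u v : List A} (hv : IsRightSpecial L v) (h : u <:+ v) :
    IsRightSpecial L u := by
  obtain ⟨a, b, hab, ha, hb⟩ := hv
  obtain ⟨t, rfl⟩ := h
  exact ⟨a, b, hab, ha.of_infix ⟨t, [], by simp⟩, hb.of_infix ⟨t, [], by simp⟩⟩

theorem IsLeftSpecial.of_prefix {u v : List A} (hv : IsLeftSpecial L v) (h : u <+: v) :
    IsLeftSpecial L u := by
  obtain ⟨a, b, hab, ha, hb⟩ := hv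
  obtain ⟨t, rfl⟩ := h
  exact ⟨a, b, hab, ha.of_infix ⟨[], t, by simp⟩, hb.of_infix ⟨[], t, by simp⟩⟩

theorem IsLeftSpecial.isFactor {v : List A} (h : IsLeftSpecial L v) : IsFactor L v := by
  obtain ⟨a, _, _, ha, _⟩ := h
  exact ha.of_infix ⟨[a], [], by simp⟩

theorem IsBranching.isRightSpecial {v : List A} (h : IsBranching L v) : IsRightSpecial L v := by
  obtain ⟨a, _, _, ha, _⟩ := h
  exact ha.of_suffix (List.suffix_cons a v)

theorem IsBranching.isLeftSpecial {v : List A} (h : IsBranching L v) : IsLeftSpecial L v := by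
  obtain ⟨a, b, hab, ha, hb⟩ := h
  exact ⟨a, b, hab, ha.isFactor, hb.isFactor⟩

/-- A branching factor has a two-sided extension avoiding a given letter on each side. -/
theorem IsBranching.exists_ne {v : List A} (h : IsBranching L v) (c a : Option A) :
    ∃ d b : A, some d ≠ c ∧ some b ≠ a ∧ IsFactor L (d :: v ++ [b]) := by
  have key : ∀ {x y : A} (_ : x ≠ y) (o : Option A), some x ≠ o ∨ some y ≠ o := by
    intro x y hxy o
    by_contra! hcon
    exact hxy (Option.some.inj (hcon.1.trans hcon.2.symm))
  obtain ⟨x, y, hxy, hx, hy⟩ := h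
  obtain ⟨d, hd, e, f, hef, he, hf⟩ : ∃ d, some d ≠ c ∧ IsRightSpecial L (d :: v) := by
    rcases key hxy c with h | h
    exacts [⟨x, h, hx⟩, ⟨y, h, hy⟩]
  rcases key hef a with h | h
  exacts [⟨d, e, hd, h, he⟩, ⟨d, f, hd, h, hf⟩]

/-- A branching word `w`, together with a position `i`, yields a factor of prescribed length in which
`w` occurs at `i` and both neighbouring letters avoid given values. -/
theorem Prolongable.exists_window (hL : Prolongable L) {w : List A} (hw : IsBranching L w)
    (c a : Option A) {i N : ℕ} (hi : 1 ≤ i) (hN : i + w.length + 1 ≤ N) :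
    ∃ z : List A, z.length = N ∧ IsFactor L z ∧ z[i - 1]? ≠ c ∧ z[i + w.length]? ≠ a ∧
      ∀ t < w.length, z[i + t]? = w[t]? := by
  obtain ⟨d, b, hd, hb, hdb⟩ := hw.exists_ne c a
  obtain ⟨x, y, hx, hy, h⟩ := hL.exists_extension hdb (i - 1) (N - (i + w.length + 1))
  refine ⟨_, ?_, h, ?_, ?_, fun t ht => ?_⟩
  · simp
    omega
  · simpa [← hx] using hd
  · rw [show i + w.length = (x ++ (d :: w)).length by simp; omega]
    rw [← List.append_assoc x, List.append_assoc _ [b] y, List.getElem?_append_right le_rfl]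
    simpa using hb
  · rw [show i + t = x.length + (t + 1) by omega]
    simp [List.getElem?_append, ht]

theorem exists_complexity_succ_le {K n l : ℕ} (hln : l ≤ n) (hK : complexity L n < l * (K + 1)) :
    ∃ m, n - l ≤ m ∧ m < n ∧ complexity L (m + 1) ≤ complexity L m + K := by
  by_contra! hcon
  have key : ∀ j ≤ l, j * (K + 1) ≤ complexity L (n - l + j) := by
    intro j
    induction j with
    | zero => simp
    | succ j ih =>
      intro hj
      have h1 := ih (by omega)
      have h2 := hcon (n - l + j) (by omega) (by omega)
      rw [← Nat.add_assoc, Nat.add_mul]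
      omega
  have := key l le_rfl
  rw [Nat.sub_add_cancel hln] at this
  omega

end Factors

section Periods

variable {A : Type*}

/-- The finite word `u` has period `p`. -/
def HasPeriodAt (u : List A) (p : ℕ) : Prop :=
  ∀ t, t + p < u.length → u[t]? = u[t + p]?

/-- All small periods of a word prescribe the same letter on its left. -/
theorem exists_left_continuation (u : List A) : ∃ c : Option A, ∀ p, 1 ≤ p → 2 * p ≤ u.length →
    HasPeriodAt u p → u[p - 1]? = c := by
  by_cases h : ∃ p, 1 ≤ p ∧ 2 * p ≤ u.length ∧ HasPeriodAt u p
  · obtain ⟨q, hq1, hq, hqu⟩ := h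
    refine ⟨u[q - 1]?, fun p hp1 hp hpu => ?_⟩
    rw [hqu (p - 1) (by omega), hpu (q - 1) (by omega)]
    congr 1
    omega
  · push Not at h
    exact ⟨none, fun p hp1 hp hpu => (h p hp1 hp hpu).elim⟩

/-- All small periods of a word prescribe the same letter on its right. -/
theorem exists_right_continuation (u : List A) : ∃ c : Option A, ∀ p, 1 ≤ p → 2 * p ≤ u.length →
    HasPeriodAt u p → u[u.length - p]? = c := by
  by_cases h : ∃ p, 1 ≤ p ∧ 2 * p ≤ u.length ∧ HasPeriodAt u p
  · obtain ⟨q, hq1, hq, hqu⟩ := h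
    refine ⟨u[u.length - q]?, fun p hp1 hp hpu => ?_⟩
    have h1 := hqu (u.length - p - q) (by omega)
    have h2 := hpu (u.length - p - q) (by omega)
    rw [show u.length - p - q + q = u.length - p by omega] at h1
    rw [show u.length - p - q + p = u.length - q by omega] at h2
    rw [← h1, h2]
  · push Not at h
    exact ⟨none, fun p hp1 hp hpu => (h p hp1 hp hpu).elim⟩

/-- If `u` occurs in `z` at two close positions, the second occurrence is preceded by the
letter prescribed by the periods of `u`. -/
theorem left_letter_eq {u z : List A} {c : Option A}
    (hc : ∀ p, 1 ≤ p → 2 * p ≤ u.length → HasPeriodAt u p → u[p - 1]? = c) {i j : ℕ}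
    (hij : i < j) (hji : 2 * (j - i) ≤ u.length) (hi : ∀ t < u.length, z[i + t]? = u[t]?)
    (hj : ∀ t < u.length, z[j + t]? = u[t]?) : z[j - 1]? = c := by
  have hper : HasPeriodAt u (j - i) := by
    intro t ht
    rw [← hj t (by omega), ← hi _ ht]
    congr 1
    omega
  rw [← hc (j - i) (by omega) hji hper, ← hi _ (by omega)]
  congr 1
  omega

/-- If `u` occurs in `z` at two close positions, the first occurrence is followed by the
letter prescribed by the periods of `u`. -/
theorem right_letter_eq {u z : List A} {c : Option A}
    (hc : ∀ p, 1 ≤ p → 2 * p ≤ u.length → HasPeriodAt u p → u[u.length - p]? = c) {i j : ℕ}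
    (hij : i < j) (hji : 2 * (j - i) ≤ u.length) (hi : ∀ t < u.length, z[i + t]? = u[t]?)
    (hj : ∀ t < u.length, z[j + t]? = u[t]?) : z[i + u.length]? = c := by
  have hper : HasPeriodAt u (j - i) := by
    intro t ht
    rw [← hj t (by omega), ← hi _ ht]
    congr 1
    omega
  rw [← hc (j - i) (by omega) hji hper, ← hj _ (by omega)]
  congr 1
  omega

end Periods

section Complexity

variable {A : Type*} [Fintype A] {L : Set (ℕ → A)}

open Classical in
/-- The finite set of factors of length `n` satisfying `P`. -/
noncomputable def factorsWith (L : Set (ℕ → A)) (P : List A → Prop) (n : ℕ) : Finset (List A) :=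
  (List.finite_length_eq A n).toFinset.filter fun v => IsFactor L v ∧ P v

@[simp]
theorem mem_factorsWith {P : List A → Prop} {n : ℕ} {v : List A} :
    v ∈ factorsWith L P n ↔ v.length = n ∧ IsFactor L v ∧ P v := by
  simp [factorsWith]

theorem card_factorsWith_true (n : ℕ) :
    (factorsWith L (fun _ => True) n).card = complexity L n := by
  rw [complexity, ← Nat.card_eq_finsetCard]
  exact Nat.card_congr (Equiv.subtypeEquivRight fun v => by simp)

theorem complexity_add_card_rightSpecial_le (n : ℕ) :
    complexity L n + (factorsWith L (IsRightSpecial L) n).card ≤ complexity L (n + 1) := by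
  classical
  rw [← card_factorsWith_true, ← card_factorsWith_true]
  refine le_trans (Nat.add_le_add_left (Finset.card_le_card ?_) _)
    (card_add_card_branching_le List.dropLast (fun v a => v ++ [a]) ?_ ?_ ?_ ?_)
  · intro v hv
    simp only [mem_factorsWith, Finset.mem_filter] at hv ⊢
    obtain ⟨hn, hv, a, b, hab, ha, hb⟩ := hv
    exact ⟨⟨hn, hv, trivial⟩, a, b, hab, ⟨by simp [hn], ha, trivial⟩, by simp [hn], hb, trivial⟩
  · intro v hv
    simp only [mem_factorsWith] at hv ⊢
    exact ⟨by simp [hv.1], hv.2.1.of_infix (List.dropLast_prefix v).isInfix, trivial⟩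
  · simp
  · intro v a b hab
    simpa using hab
  · intro v hv
    simp only [mem_factorsWith] at hv ⊢
    obtain ⟨b, hb⟩ := hv.2.1.exists_append
    exact ⟨b, by simp [hv.1], hb, trivial⟩

theorem Prolongable.complexity_add_card_leftSpecial_le (hL : Prolongable L) (n : ℕ) :
    complexity L n + (factorsWith L (IsLeftSpecial L) n).card ≤ complexity L (n + 1) := by
  classical
  rw [← card_factorsWith_true, ← card_factorsWith_true]
  refine le_trans (Nat.add_le_add_left (Finset.card_le_card ?_) _)
    (card_add_card_branching_le List.tail (fun v a => a :: v) ?_ ?_ ?_ ?_)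
  · intro v hv
    simp only [mem_factorsWith, Finset.mem_filter] at hv ⊢
    obtain ⟨hn, hv, a, b, hab, ha, hb⟩ := hv
    exact ⟨⟨hn, hv, trivial⟩, a, b, hab, ⟨by simp [hn], ha, trivial⟩, by simp [hn], hb, trivial⟩
  · intro v hv
    simp only [mem_factorsWith] at hv ⊢
    exact ⟨by simp [hv.1], hv.2.1.of_infix (List.tail_suffix v).isInfix, trivial⟩
  · simp
  · intro v a b hab
    simpa using hab
  · intro v hv
    simp only [mem_factorsWith] at hv ⊢
    obtain ⟨b, hb⟩ := (hL v hv.2.1).1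
    exact ⟨b, by simp [hv.1], hb, trivial⟩

theorem complexity_succ_le (n : ℕ) : complexity L (n + 1) ≤
    complexity L n + Fintype.card A * (factorsWith L (IsRightSpecial L) n).card := by
  classical
  rw [← card_factorsWith_true, ← card_factorsWith_true]
  refine (card_le_card_add_mul_card_branching List.dropLast (fun v a => v ++ [a]) ?_ ?_).trans
    (Nat.add_le_add_left (Nat.mul_le_mul_left _ (Finset.card_le_card ?_)) _)
  · intro v hv
    simp only [mem_factorsWith] at hv ⊢
    exact ⟨by simp [hv.1], hv.2.1.of_infix (List.dropLast_prefix v).isInfix, trivial⟩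
  · intro v hv
    simp only [mem_factorsWith] at hv
    have hne : v ≠ [] := by
      rintro rfl
      simp at hv
    exact ⟨v.getLast hne, List.dropLast_append_getLast hne⟩
  · intro v hv
    simp only [mem_factorsWith, Finset.mem_filter] at hv ⊢
    obtain ⟨⟨hn, hv, _⟩, a, b, hab, ha, hb⟩ := hv
    exact ⟨hn, hv, a, b, hab, ha.2.1, hb.2.1⟩

theorem card_rightSpecial_succ_le (n : ℕ) : (factorsWith L (IsRightSpecial L) (n + 1)).card ≤
    (factorsWith L (IsRightSpecial L) n).card +
      Fintype.card A * (factorsWith L (IsBranching L) n).card := by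
  classical
  refine (card_le_card_add_mul_card_branching List.tail (fun v a => a :: v) ?_ ?_).trans
    (Nat.add_le_add_left (Nat.mul_le_mul_left _ (Finset.card_le_card ?_)) _)
  · intro v hv
    simp only [mem_factorsWith] at hv ⊢
    have := List.tail_suffix v
    exact ⟨by simp [hv.1], hv.2.1.of_infix this.isInfix, hv.2.2.of_suffix this⟩
  · rintro (_ | ⟨a, v⟩) hv
    · simp at hv
    · exact ⟨a, rfl⟩
  · intro v hv
    simp only [mem_factorsWith, Finset.mem_filter] at hv ⊢
    obtain ⟨⟨hn, hv, _⟩, a, b, hab, ha, hb⟩ := hv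
    exact ⟨hn, hv, a, b, hab, ha.2.2, hb.2.2⟩

theorem card_rightSpecial_add_le (m k : ℕ) : (factorsWith L (IsRightSpecial L) (m + k)).card ≤
    (factorsWith L (IsRightSpecial L) m).card +
      Fintype.card A * ∑ j ∈ Finset.Ico m (m + k), (factorsWith L (IsBranching L) j).card := by
  induction k with
  | zero => simp
  | succ k ih =>
    rw [← Nat.add_assoc, Finset.sum_Ico_succ_top (by omega), Nat.mul_add]
    have := card_rightSpecial_succ_le (L := L) (m + k)
    omega

/-- Branching words with lengths in `[m, n)` are determined by their prefix and suffix of length `m`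
together with the windows in which they occur. -/
theorem Prolongable.mul_sum_card_branching_le (hL : Prolongable L) {m n I : ℕ}
    (hI : 2 * (I + (n - m)) ≤ m) :
    I * ∑ j ∈ Finset.Ico m n, (factorsWith L (IsBranching L) j).card ≤
      complexity L (I + n) * ((factorsWith L (IsLeftSpecial L) m).card *
        (factorsWith L (IsRightSpecial L) m).card) := by
  classical
  have hdisj : ((Finset.Ico m n : Finset ℕ) : Set ℕ).PairwiseDisjoint
      (factorsWith L (IsBranching L)) := by
    intro i _ j _ hij
    refine Finset.disjoint_left.2 fun v hv hv' => hij ?_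
    exact (mem_factorsWith.1 hv).1.symm.trans (mem_factorsWith.1 hv').1
  choose cl hcl using exists_left_continuation (A := A)
  choose cr hcr using exists_right_continuation (A := A)
  rw [← Finset.card_biUnion hdisj, ← card_factorsWith_true, ← Finset.card_product,
    ← Finset.card_product, mul_comm I]
  have hcard : (Finset.Icc 1 I).card = I := by simp
  nth_rewrite 1 [← hcard]
  rw [← Finset.card_product]
  set B := (Finset.Ico m n).biUnion (factorsWith L (IsBranching L)) with hB
  have hBmem : ∀ {w}, w ∈ B → m ≤ w.length ∧ w.length < n ∧ IsBranching L w := by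
    intro w hw
    simp only [hB, Finset.mem_biUnion, Finset.mem_Ico, mem_factorsWith] at hw
    obtain ⟨j, ⟨h1, h2⟩, rfl, -, h3⟩ := hw
    exact ⟨h1, h2, h3⟩
  have hwin : ∀ q : List A × ℕ, ∃ z : List A, q ∈ B ×ˢ Finset.Icc 1 I →
      z.length = I + n ∧ IsFactor L z ∧ z[q.2 - 1]? ≠ cl (q.1.take m) ∧
      z[q.2 + q.1.length]? ≠ cr (q.1.drop (q.1.length - m)) ∧
      ∀ t < q.1.length, z[q.2 + t]? = q.1[t]? := by
    rintro ⟨w, i⟩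
    by_cases hq : (w, i) ∈ B ×ˢ Finset.Icc 1 I
    · obtain ⟨hw, hi⟩ := Finset.mem_product.1 hq
      obtain ⟨-, hwn, hw⟩ := hBmem hw
      rw [Finset.mem_Icc] at hi
      obtain ⟨z, hz⟩ := hL.exists_window hw (cl (w.take m)) (cr (w.drop (w.length - m))) hi.1
        (N := I + n) (by simp only at hi; omega)
      exact ⟨z, fun _ => hz⟩
    · exact ⟨[], fun h => (hq h).elim⟩
  choose win hwin using hwin
  refine Finset.card_le_card_of_injOn
    (fun q => (win q, q.1.take m, q.1.drop (q.1.length - m))) ?_ ?_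
  · rintro ⟨w, i⟩ hq
    obtain ⟨h1, h2, -⟩ := hwin _ hq
    obtain ⟨hmw, -, hw⟩ := hBmem (Finset.mem_product.1 hq).1
    have hl := hw.isLeftSpecial.of_prefix (List.take_prefix m w)
    have hr := hw.isRightSpecial.of_suffix (List.drop_suffix (w.length - m) w)
    have hlen : (w.drop (w.length - m)).length = m := by
      rw [List.length_drop]
      exact Nat.sub_sub_self hmw
    simp only [Finset.coe_product, Set.mem_prod, Finset.mem_coe, mem_factorsWith]
    exact ⟨⟨h1, h2, trivial⟩, ⟨by simpa using hmw, hl.isFactor, hl⟩,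
      hlen, hr.isFactor, hr⟩
  · -- Two hits of the same window start, and end, at the same position.
    have hstart : ∀ {q q' : List A × ℕ}, q ∈ B ×ˢ Finset.Icc 1 I → q' ∈ B ×ˢ Finset.Icc 1 I →
        win q = win q' → q.1.take m = q'.1.take m → ¬ q.2 < q'.2 := by
      intro q q' hq hq' hz hl hlt
      obtain ⟨-, -, -, -, hocc⟩ := hwin _ hq
      obtain ⟨-, -, hne, -, hocc'⟩ := hwin _ hq'
      obtain ⟨hB1, hi⟩ := Finset.mem_product.1 hq
      obtain ⟨hB2, hi'⟩ := Finset.mem_product.1 hq'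
      obtain ⟨hm1, hn1, -⟩ := hBmem hB1
      obtain ⟨hm2, hn2, -⟩ := hBmem hB2
      rw [Finset.mem_Icc] at hi hi'
      have hlen : (q'.1.take m).length = m := by simpa using hm2
      refine hne (left_letter_eq (hcl _) hlt (by omega) (fun t ht => ?_) (fun t ht => ?_))
      · rw [← hz, hocc t (by omega), ← hl, List.getElem?_take_of_lt (by omega)]
      · rw [hocc' t (by omega), List.getElem?_take_of_lt (by omega)]
    have hend : ∀ {q q' : List A × ℕ}, q ∈ B ×ˢ Finset.Icc 1 I → q' ∈ B ×ˢ Finset.Icc 1 I →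
        win q = win q' → q.1.drop (q.1.length - m) = q'.1.drop (q'.1.length - m) →
        ¬ q.2 + q.1.length < q'.2 + q'.1.length := by
      intro q q' hq hq' hz hr hlt
      obtain ⟨-, -, -, hne, hocc⟩ := hwin _ hq
      obtain ⟨-, -, -, -, hocc'⟩ := hwin _ hq'
      obtain ⟨hB1, hi⟩ := Finset.mem_product.1 hq
      obtain ⟨hB2, hi'⟩ := Finset.mem_product.1 hq'
      obtain ⟨hm1, hn1, -⟩ := hBmem hB1
      obtain ⟨hm2, hn2, -⟩ := hBmem hB2
      rw [Finset.mem_Icc] at hi hi'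
      have hlen : (q.1.drop (q.1.length - m)).length = m := by
        simp only [List.length_drop]
        omega
      have key := right_letter_eq (z := win q) (hcr (q.1.drop (q.1.length - m)))
        (i := q.2 + (q.1.length - m)) (j := q'.2 + (q'.1.length - m)) (by omega) (by omega)
        (fun t ht => ?_) (fun t ht => ?_)
      · rw [hlen, show q.2 + (q.1.length - m) + m = q.2 + q.1.length by omega] at key
        exact hne key
      · rw [List.getElem?_drop, Nat.add_assoc, hocc _ (by omega)]
      · rw [hr, List.getElem?_drop, hz, Nat.add_assoc, hocc' _ (by omega)]
    intro q hq q' hq' h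
    rw [Finset.mem_coe] at hq hq'
    simp only [Prod.mk.injEq] at h
    obtain ⟨hz, hl, hr⟩ := h
    have hi : q.2 = q'.2 :=
      le_antisymm (not_lt.1 (hstart hq' hq hz.symm hl.symm)) (not_lt.1 (hstart hq hq' hz hl))
    have hj : q.2 + q.1.length = q'.2 + q'.1.length :=
      le_antisymm (not_lt.1 (hend hq' hq hz.symm hr.symm)) (not_lt.1 (hend hq hq' hz hr))
    refine Prod.ext (List.ext_getElem? fun t => ?_) hi
    by_cases ht : t < q.1.length
    · rw [← (hwin _ hq).2.2.2.2 t ht, ← (hwin _ hq').2.2.2.2 t (by omega), hz, hi]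
    · rw [List.getElem?_eq_none (by omega), List.getElem?_eq_none (by omega)]

/-- A prolongable language with linear complexity has a complexity function with bounded first
differences. -/
theorem Prolongable.exists_complexity_succ_le_add (hL : Prolongable L) {C : ℕ}
    (hC : ∀ n, 1 ≤ n → complexity L n ≤ C * n) :
    ∃ r, ∀ n, complexity L (n + 1) ≤ complexity L n + r := by
  set K := 16 * C with hK
  set R := K + Fintype.card A * (C * 17 * (K * K)) with hR
  refine ⟨C * 8 + Fintype.card A * R, fun n => ?_⟩
  rcases Nat.lt_or_ge n 8 with hn | hn
  · have h1 := hC (n + 1) (by omega)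
    have h2 : C * (n + 1) ≤ C * 8 := Nat.mul_le_mul_left _ (by omega)
    omega
  obtain ⟨l, hl1, hl2, hl3⟩ : ∃ l, 1 ≤ l ∧ 8 * l ≤ n ∧ n ≤ 16 * l := ⟨n / 8, by omega⟩
  obtain ⟨m, hm1, hm2, hm⟩ := exists_complexity_succ_le (L := L) (K := K) (n := n) (l := l)
    (by omega) (by have := hC n (by omega); nlinarith [Nat.mul_le_mul_left C hl3])
  have hRm := complexity_add_card_rightSpecial_le (L := L) m
  have hLm := hL.complexity_add_card_leftSpecial_le m
  have hB := hL.mul_sum_card_branching_le (m := m) (n := n) (I := l) (by omega)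
  have hRn := card_rightSpecial_add_le (L := L) m (n - m)
  rw [Nat.add_sub_cancel' hm2.le] at hRn
  set S := ∑ j ∈ Finset.Ico m n, (factorsWith L (IsBranching L) j).card
  have hS : S ≤ C * 17 * (K * K) := by
    refine Nat.le_of_mul_le_mul_left (hB.trans ?_) hl1
    calc _ ≤ C * (17 * l) * (K * K) := by
          refine Nat.mul_le_mul ((hC _ (by omega)).trans (Nat.mul_le_mul_left _ (by omega))) ?_
          exact Nat.mul_le_mul (by omega) (by omega)
      _ = l * (C * 17 * (K * K)) := by ring
  have hRn' : (factorsWith L (IsRightSpecial L) n).card ≤ R :=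
    hRn.trans (Nat.add_le_add (by omega) (Nat.mul_le_mul_left _ hS))
  have := complexity_succ_le (L := L) n
  have := Nat.mul_le_mul_left (Fintype.card A) hRn'
  omega

theorem complexity_le_succ (n : ℕ) : complexity L n ≤ complexity L (n + 1) :=
  (Nat.le_add_right _ _).trans (complexity_add_card_rightSpecial_le n)

/-- The complexity of an infinite set of infinite words is unbounded. -/
theorem tendsto_complexity_atTop (hL : L.Infinite) :
    Tendsto (fun n => complexity L n) atTop atTop := by
  classical
  refine tendsto_atTop_atTop_of_monotone (monotone_nat_of_le_succ complexity_le_succ) fun N => ?_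
  obtain ⟨S, hSL, hS⟩ := hL.exists_subset_card_eq N
  have hsep : ∀ q : (ℕ → A) × (ℕ → A), ∃ i, q.1 ≠ q.2 → q.1 i ≠ q.2 i := by
    intro q
    by_cases h : q.1 = q.2
    · exact ⟨0, fun h' => (h' h).elim⟩
    · obtain ⟨i, hi⟩ := Function.ne_iff.1 h
      exact ⟨i, fun _ => hi⟩
  choose sep hsep using hsep
  refine ⟨(S ×ˢ S).sup sep + 1, ?_⟩
  rw [← hS, ← card_factorsWith_true]
  refine Finset.card_le_card_of_injOn (fun w => prefixWord w ((S ×ˢ S).sup sep + 1)) ?_ ?_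
  · intro w hw
    refine mem_factorsWith.2 ⟨by simp [prefixWord], ⟨w, hSL hw, 0, occursAt_iff.2 fun i hi => ?_⟩,
      trivial⟩
    simp only [prefixWord, List.length_ofFn] at hi
    simp only [prefixWord, List.getElem?_ofFn, dif_pos hi, Nat.zero_add]
  · intro w hw w' hw' h
    by_contra hne
    refine hsep (w, w') hne ?_
    have hle : sep (w, w') ≤ (S ×ˢ S).sup sep :=
      Finset.le_sup (f := sep) (Finset.mem_product.2 ⟨hw, hw'⟩)
    exact congrFun (List.ofFn_injective h) ⟨sep (w, w'), by omega⟩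

end Complexity

section MinimalShift

variable {A : Type*} {L : Set (ℕ → A)}

theorem IsMinimalShift.image_shiftMap [Finite A] [TopologicalSpace A] [DiscreteTopology A]
    (hL : IsMinimalShift L) : shiftMap '' L = L := by
  obtain ⟨⟨hclosed, hshift⟩, hne, hmin⟩ := hL
  refine hmin _ (Set.image_subset_iff.2 hshift) ⟨?_, ?_⟩ (hne.image _)
  · have hcont : Continuous (shiftMap : (ℕ → A) → ℕ → A) :=
      continuous_pi fun n => continuous_apply (n + 1)
    exact (hclosed.isCompact.image hcont).isClosed
  · rintro _ ⟨w, hw, rfl⟩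
    exact ⟨_, hshift w hw, rfl⟩

theorem IsMinimalShift.prolongable [Finite A] [TopologicalSpace A] [DiscreteTopology A]
    (hL : IsMinimalShift L) : Prolongable L := by
  refine fun v hv => ⟨?_, hv.exists_append⟩
  obtain ⟨w, hw, j, hj⟩ := hv
  rw [← hL.image_shiftMap] at hw
  obtain ⟨w', hw', rfl⟩ := hw
  rw [occursAt_iff] at hj
  refine ⟨w' j, w', hw', j, occursAt_iff.2 fun i hi => ?_⟩
  cases i with
  | zero => simp
  | succ i =>
    rw [List.getElem?_cons_succ, hj i (by simpa using hi)]
    rfl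

theorem IsAperiodic.infinite (haper : IsAperiodic L) (hne : L.Nonempty)
    (hshift : ∀ w ∈ L, shiftMap w ∈ L) : L.Infinite := by
  intro hfin
  obtain ⟨w, hw⟩ := hne
  have hiter : ∀ k, shiftMap^[k] w ∈ L := by
    intro k
    induction k with
    | zero => exact hw
    | succ k ih =>
      rw [Function.iterate_succ_apply']
      exact hshift _ ih
  obtain ⟨i, -, j, -, hij, h⟩ := Set.infinite_univ.exists_lt_map_eq_of_mapsTo
    (f := fun k : ℕ => shiftMap^[k] w) (fun k _ => hiter k) hfin
  refine haper _ (hiter i) (j - i) (by omega) ?_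
  rw [← Function.iterate_add_apply, Nat.sub_add_cancel hij.le]
  exact h.symm

end MinimalShift

/-- An aperiodic minimal shift with linear complexity has bounded first
differences of `p_L`, and consequently `p_L(n)/p_L(n−1) → 1`. -/
theorem bounded_differences_and_slopes_tendsto_one_of_linear_complexity
    {A : Type*} [Fintype A] [TopologicalSpace A] [DiscreteTopology A]
    (L : Set (ℕ → A)) (hL : IsMinimalShift L) (haper : IsAperiodic L)
    (hlin : ∃ C : ℕ, ∀ n : ℕ, 1 ≤ n → complexity L n ≤ C * n) :
    ∃ r : ℕ, 0 < r ∧ (∀ n : ℕ, 2 ≤ n → complexity L n ≤ complexity L (n - 1) + r) ∧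
      Tendsto (fun n : ℕ =>
        (complexity L n : ℝ) / (complexity L (n - 1) : ℝ)) atTop (𝓝 1) := by
  obtain ⟨C, hC⟩ := hlin
  obtain ⟨r, hr⟩ := hL.prolongable.exists_complexity_succ_le_add hC
  have hbound : ∀ n, 1 ≤ n → complexity L n ≤ complexity L (n - 1) + (r + 1) := by
    intro n hn
    have := hr (n - 1)
    rw [Nat.sub_add_cancel hn] at this
    omega
  refine ⟨r + 1, r.succ_pos, fun n hn => hbound n (by omega), ?_⟩
  have htop : Tendsto (fun n => (complexity L (n - 1) : ℝ)) atTop atTop :=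
    tendsto_natCast_atTop_atTop.comp ((tendsto_complexity_atTop
      (haper.infinite hL.2.1 hL.1.2)).comp (tendsto_sub_atTop_nat 1))
  have hupper : Tendsto (fun n => 1 + ((r + 1 : ℕ) : ℝ) / (complexity L (n - 1) : ℝ)) atTop
      (𝓝 1) := by
    simpa using (htop.const_div_atTop ((r + 1 : ℕ) : ℝ)).const_add 1
  refine tendsto_of_tendsto_of_tendsto_of_le_of_le' tendsto_const_nhds hupper ?_ ?_
  · filter_upwards [htop.eventually_gt_atTop 0, eventually_ge_atTop 1] with n hpos hn
    have := complexity_le_succ (L := L) (n - 1)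
    rw [Nat.sub_add_cancel hn] at this
    rw [le_div_iff₀ hpos, one_mul]
    exact_mod_cast this
  · filter_upwards [htop.eventually_gt_atTop 0, eventually_ge_atTop 1] with n hpos hn
    rw [div_le_iff₀ hpos, add_mul, div_mul_cancel₀ _ hpos.ne', one_mul]
    exact_mod_cast hbound n hn
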